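/- arXiv:2509.21001 — 5 statements merged into one kernel-verified Lean document; each statement's English description precedes it below -/
import Mathlib

section
/- Let P be an FLC, well-separated, expansive L-sub pattern on E with predecessor P'. Then there exists a function f : ℝ≥0 → ℝ≥0 such that property P_f holds: for all x ∈ E and R ≥ 0, if P[0, f(R)] = P[x, f(R)] then there exists g ∈ K_P with P'[0, R] = P'[L⁻¹x + L⁻¹g, R]. -/
open Metric Set Filter Topology Pointwise

variable {E : Type*} [NormedAddCommGroup E] [NormedSpace ℝ E] {S : Type*}

/-- Equality of the `U`-patches of the pattern `P` at `x` and of `Q` at `y`: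
`P[x,U] = Q[y,U]`. -/
def PatchEq (P Q : E → S) (x y : E) (U : Set E) : Prop :=
  ∀ u ∈ U, P (x + u) = Q (y + u)

/-- The translate `P + z` of a pattern `P`. -/
def transl (z : E) (P : E → S) : E → S := fun x => P (x - z)

/-- The distortion `L P` of a pattern `P` by a linear automorphism `L`. -/
def distort (L : E ≃ₗ[ℝ] E) (P : E → S) : E → S := fun x => P (L.symm x)

/-- `Q` is locally indistinguishable from `P` (`Q ≼ P`). -/
def LIfrom (Q P : E → S) : Prop :=
  ∀ U : Set E, IsCompact U → ∀ x : E, ∃ y : E, PatchEq Q P x y U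

/-- `P` and `Q` are locally isomorphic (`P ≈ Q`). -/
def LocIso (P Q : E → S) : Prop :=
  LIfrom P Q ∧ LIfrom Q P

/-- `Q` is locally derivable from `P` (`P ⊳ Q`). -/
def LD (P Q : E → S) : Prop :=
  ∃ c : ℝ, 0 ≤ c ∧ ∀ x y : E, PatchEq P P x y (closedBall 0 c) → Q x = Q y

/-- The group of translational periods of a pattern: `{g | P + g = P}`. -/
def periods (P : E → S) : AddSubgroup E where
  carrier := {g : E | ∀ x : E, P (x + g) = P x}
  zero_mem' := by intro x; rw [add_zero]
  add_mem' := by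
    intro a b ha hb
    simp only [Set.mem_setOf_eq] at ha hb ⊢
    intro x
    rw [← add_assoc, hb, ha]
  neg_mem' := by
    intro a ha
    simp only [Set.mem_setOf_eq] at ha ⊢
    intro x
    have h := ha (x + -a)
    have h2 : x + -a + a = x := by abel
    rw [h2] at h
    exact h.symm

/-- Finite local complexity (FLC) for a single pattern. -/
def IsFLC (P : E → S) : Prop :=
  ∀ U : Set E, IsCompact U → ∃ K : Set E, IsCompact K ∧ ∀ x : E, ∃ v ∈ K, PatchEq P P x v U

/-- Repetitivity for a single pattern. -/
def Repetitive (P : E → S) : Prop :=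
  ∀ U : Set E, IsCompact U →
    ∃ R : Set E, IsCompact R ∧ ∀ x y : E, ∃ v ∈ R, PatchEq P P x (y + v) U

/-- Well-separation for a single pattern. -/
def WellSeparated (P : E → S) : Prop :=
  ∃ V : Set E, IsCompact V ∧ ∀ x y : E, P x ≠ P y →
    ∃ B ∈ 𝓝 (0 : E), ∀ b ∈ B, ∀ b' ∈ B, ¬ PatchEq P P (x + b) (y + b') V

/-- Return discreteness for a single pattern. -/
def ReturnDiscrete (P : E → S) : Prop :=
  ∃ B ∈ 𝓝 (0 : E), ∃ V : Set E, IsCompact V ∧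
    ∀ x : E, ∀ b ∈ B, PatchEq P P x (x + b) V → b = 0

/-- The translational hull of a pattern: all patterns locally indistinguishable from it. -/
def patternHull (P : E → S) : Set (E → S) := {Q | LIfrom Q P}

/-- A pattern space: a nonempty set of patterns closed under being locally
indistinguishable from the collection. -/
def IsPatternSpace (Ω : Set (E → S)) : Prop :=
  Ω.Nonempty ∧ ∀ Q : E → S,
    (∀ U : Set E, IsCompact U → ∀ x : E, ∃ R ∈ Ω, ∃ y : E, PatchEq Q R x y U) → Q ∈ Ω

/-- Finite local complexity for a pattern space. -/
def IsFLCSpace (Ω : Set (E → S)) : Prop :=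
  ∀ U : Set E, IsCompact U → ∃ (n : ℕ) (Ps : Fin n → E → S) (Ks : Fin n → Set E),
    (∀ i, IsCompact (Ks i)) ∧ ∀ Q ∈ Ω, ∀ x : E, ∃ i, ∃ y ∈ Ks i, PatchEq Q (Ps i) x y U

/-- Well-separation for a pattern space. -/
def WellSeparatedSpace (Ω : Set (E → S)) : Prop :=
  ∃ V : Set E, IsCompact V ∧ ∀ P ∈ Ω, ∀ Q ∈ Ω, P 0 ≠ Q 0 →
    ∃ B ∈ 𝓝 (0 : E), ∀ b ∈ B, ∀ b' ∈ B, ¬ PatchEq P Q b b' V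

/-- Return discreteness for a pattern space. -/
def ReturnDiscreteSpace (Ω : Set (E → S)) : Prop :=
  ∃ B ∈ 𝓝 (0 : E), ∃ V : Set E, IsCompact V ∧
    ∀ P ∈ Ω, ∀ b ∈ B, PatchEq P P 0 b V → b = 0

/-- Repetitivity for a pattern space. -/
def RepetitiveSpace (Ω : Set (E → S)) : Prop :=
  ∀ U : Set E, IsCompact U → ∃ R : Set E, IsCompact R ∧
    ∀ P ∈ Ω, ∀ Q ∈ Ω, ∃ v ∈ R, PatchEq P Q 0 v U

/-- A local derivation (LD) map between two sets of patterns. -/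
def IsLDMapOn (f : (E → S) → (E → S)) (Ω Ω' : Set (E → S)) : Prop :=
  Set.MapsTo f Ω Ω' ∧ ∃ c : ℝ, 0 ≤ c ∧
    ∀ P ∈ Ω, ∀ Q ∈ Ω, ∀ x y : E, PatchEq P Q x y (closedBall 0 c) → f P x = f Q y

/-- An expansive linear automorphism (all eigenvalues of modulus strictly greater
than `1`; equivalently, iterates expand uniformly at an exponential rate). -/
def IsExpansive (L : E ≃ₗ[ℝ] E) : Prop :=
  ∃ C > (0 : ℝ), ∃ l > (1 : ℝ), ∀ (n : ℕ) (x : E), C * l ^ n * ‖x‖ ≤ ‖(L ^ n : E ≃ₗ[ℝ] E) x‖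

/-- `P` is `L`-sub with predecessor `P'`: `P' ≼ P` and `L P' ⊳ P`. -/
def IsLSub (L : E ≃ₗ[ℝ] E) (P P' : E → S) : Prop :=
  LIfrom P' P ∧ LD (distort L P') P

/-- An `L`-sub pattern space: `Ω` together with a surjective LD (subdivision) map
`S : L Ω → Ω`. -/
def IsLSubSpace (L : E ≃ₗ[ℝ] E) (Ω : Set (E → S)) (Sub : (E → S) → (E → S)) : Prop :=
  IsLDMapOn Sub (distort L '' Ω) Ω ∧ Set.SurjOn Sub (distort L '' Ω) Ω

/-- The substitution map `σ := S ∘ L`. -/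
def substMap (L : E ≃ₗ[ℝ] E) (Sub : (E → S) → (E → S)) : (E → S) → (E → S) :=
  fun Q => Sub (distort L Q)


/-- Well-separation passes to limits: if arbitrarily late patches around `s k → a` and `t k → b`
agree, then the pattern agrees at `a` and `b`. -/
theorem eq_of_tendsto_of_frequently_patchEq {P : E → S} {V : Set E}
    (hV : ∀ x y : E, P x ≠ P y →
      ∃ B ∈ 𝓝 (0 : E), ∀ b ∈ B, ∀ b' ∈ B, ¬ PatchEq P P (x + b) (y + b') V)
    {ι : Type*} {F : Filter ι} {s t : ι → E} {a b : E}
    (hs : Tendsto s F (𝓝 a)) (ht : Tendsto t F (𝓝 b))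
    (h : ∃ᶠ k in F, PatchEq P P (s k) (t k) V) : P a = P b := by
  by_contra hne
  obtain ⟨B, hB, hsep⟩ := hV a b hne
  have hs' : Tendsto (fun k => s k - a) F (𝓝 0) := by simpa using hs.sub_const a
  have ht' : Tendsto (fun k => t k - b) F (𝓝 0) := by simpa using ht.sub_const b
  obtain ⟨k, hk, hks, hkt⟩ :=
    (h.and_eventually ((hs'.eventually_mem hB).and (ht'.eventually_mem hB))).exists
  apply hsep _ hks _ hkt
  simpa using hk

theorem LIfrom.trans {Q Q' Q'' : E → S} (h : LIfrom Q Q') (h' : LIfrom Q' Q'') :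
    LIfrom Q Q'' := by
  intro U hU x
  obtain ⟨y, hy⟩ := h U hU x
  obtain ⟨z, hz⟩ := h' U hU y
  exact ⟨z, fun u hu => (hy u hu).trans (hz u hu)⟩

theorem LIfrom.refl (Q : E → S) : LIfrom Q Q := fun _ _ x => ⟨x, fun _ _ => rfl⟩

/-- The subdivision rule, phrased for the undistorted predecessor. -/
theorem IsLSub.exists_radius [FiniteDimensional ℝ E] {L : E ≃ₗ[ℝ] E} {P P' : E → S}
    (h : IsLSub L P P') :
    ∃ c : ℝ, 0 ≤ c ∧ ∀ x y : E, PatchEq P' P' x y (closedBall 0 c) → P (L x) = P (L y) := by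
  obtain ⟨c, hc, hcd⟩ := h.2
  let T := LinearMap.toContinuousLinearMap (L.symm : E →ₗ[ℝ] E)
  refine ⟨‖T‖ * c, by positivity, fun x y hxy => hcd _ _ fun u hu => ?_⟩
  have hT : ‖L.symm u‖ ≤ ‖T‖ * c := by
    refine (T.le_opNorm u).trans ?_
    gcongr
    simpa using hu
  have := hxy (L.symm u) (by simpa using hT)
  simpa [distort] using this

/-- Every pattern locally indistinguishable from an FLC, well-separated `L`-sub pattern has itself
a predecessor, subject to the same subdivision rule. -/
theorem exists_predecessor [FiniteDimensional ℝ E] (L : E ≃ₗ[ℝ] E) {P P' : E → S}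
    (hFLC : IsFLC P) (hWS : WellSeparated P) (hP' : LIfrom P' P) {c : ℝ}
    (hc : ∀ x y : E, PatchEq P' P' x y (closedBall 0 c) → P (L x) = P (L y))
    {Q : E → S} (hQ : LIfrom Q P) :
    ∃ A : E → S, LIfrom A P' ∧
      ∀ x y : E, PatchEq A P' x y (closedBall 0 c) → Q (L x) = P (L y) := by
  have : ProperSpace E := FiniteDimensional.proper_real E
  obtain ⟨V, hVc, hV⟩ := hWS
  obtain ⟨r, hr⟩ := hVc.isBounded.subset_closedBall (0 : E)
  have hr' : ∀ u ∈ V, ‖u‖ ≤ r := fun u hu => by simpa using hr hu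
  choose y hy using fun k : ℕ => hQ (closedBall 0 k) (isCompact_closedBall _ _) 0
  choose K hKc hK using fun ρ : ℕ => hFLC (closedBall 0 ρ) (isCompact_closedBall _ _)
  have hv : ∀ ρ k : ℕ, ∃ v ∈ K ρ, PatchEq P' P (L.symm (y k)) v (closedBall 0 ρ) := by
    intro ρ k
    obtain ⟨z, hz⟩ := hP' (closedBall 0 (ρ : ℝ)) (isCompact_closedBall _ _) (L.symm (y k))
    obtain ⟨v, hvK, hv⟩ := hK ρ z
    exact ⟨v, hvK, fun u hu => (hz u hu).trans (hv u hu)⟩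
  choose v hvK hv using hv
  have hlim : ∀ ρ : ℕ, ∃ a : E, Tendsto (v ρ) (hyperfilter ℕ : Filter ℕ) (𝓝 a) := by
    intro ρ
    obtain ⟨a, -, ha⟩ := (hKc ρ).ultrafilter_le_nhds ((hyperfilter ℕ).map (v ρ))
      (by
        rw [Ultrafilter.coe_map, le_principal_iff, mem_map]
        exact univ_mem' fun k => hvK ρ k)
    exact ⟨a, ha⟩
  choose a ha using hlim
  have hconsist : ∀ (ρ ρ' : ℕ) (x : E), ‖x‖ + r ≤ ρ → ‖x‖ + r ≤ ρ' →
      P (a ρ + x) = P (a ρ' + x) := by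
    intro ρ ρ' x hρ hρ'
    refine eq_of_tendsto_of_frequently_patchEq hV ((ha ρ).add_const x) ((ha ρ').add_const x)
      (Eventually.of_forall fun k u hu => ?_).frequently
    have hn : ‖x + u‖ ≤ ‖x‖ + r := (norm_add_le _ _).trans (by gcongr; exact hr' u hu)
    rw [add_assoc, add_assoc, ← hv ρ k (x + u) (by simpa using hn.trans hρ),
      ← hv ρ' k (x + u) (by simpa using hn.trans hρ')]
  let A : E → S := fun x => P (a ⌈‖x‖ + r⌉₊ + x)
  have hA : ∀ (ρ : ℕ) (x : E), ‖x‖ + r ≤ ρ → A x = P (a ρ + x) := fun ρ x hρ =>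
    hconsist _ _ x (Nat.le_ceil _) hρ
  have hAP' : ∀ ρ : ℕ, ∀ᶠ k in (hyperfilter ℕ : Filter ℕ), ∀ x : E, ‖x‖ + r ≤ ρ → ‖x‖ + 1 ≤ ρ →
      A x = P' (L.symm (y k) + (a ρ - v ρ k) + x) := by
    intro ρ
    have h0 : Tendsto (fun k => a ρ - v ρ k) (hyperfilter ℕ : Filter ℕ) (𝓝 0) := by
      simpa using (ha ρ).const_sub (a ρ)
    filter_upwards [h0.eventually_mem (closedBall_mem_nhds 0 one_pos)] with k hk x hx hx'
    have hk' : ‖a ρ - v ρ k‖ ≤ 1 := by simpa using hk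
    have hn : ‖a ρ - v ρ k + x‖ ≤ ρ := (norm_add_le _ _).trans (by linarith)
    rw [hA ρ x hx, add_assoc, hv ρ k _ (by simpa using hn)]
    congr 1
    abel
  have hALI : LIfrom A P' := by
    intro U hU x
    obtain ⟨s, hs⟩ := hU.isBounded.subset_closedBall (0 : E)
    obtain ⟨ρ, hρ⟩ := exists_nat_ge (‖x‖ + s + |r| + 1)
    obtain ⟨k, hk⟩ := (hAP' ρ).exists
    refine ⟨L.symm (y k) + (a ρ - v ρ k) + x, fun u hu => ?_⟩
    have hus : ‖u‖ ≤ s := by simpa using hs hu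
    have := norm_add_le x u
    have := le_abs_self r
    have := abs_nonneg r
    rw [hk (x + u) (by linarith) (by linarith), ← add_assoc]
  refine ⟨A, hALI, fun x z hxz => ?_⟩
  let T := LinearMap.toContinuousLinearMap (L : E →ₗ[ℝ] E)
  let T' := LinearMap.toContinuousLinearMap (L.symm : E →ₗ[ℝ] E)
  obtain ⟨z', hz'⟩ := hALI (closedBall 0 (‖T'‖ * |r| + |c|)) (isCompact_closedBall _ _) x
  have hzz' : P (L z') = P (L z) := by
    refine hc _ _ fun u hu => ?_
    rw [← hxz u hu, hz' u]
    have : ‖u‖ ≤ c := by simpa using hu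
    have : 0 ≤ ‖T'‖ * |r| := by positivity
    have := le_abs_self c
    simp only [mem_closedBall, dist_zero_right]
    linarith
  rw [← hzz']
  obtain ⟨t, ht⟩ := hQ (closedBall 0 (‖L x‖ + ‖T‖ + |r|)) (isCompact_closedBall _ _) 0
  have htx : Q (L x) = P (t + L x) := by
    have := ht (L x) (by
      simp only [mem_closedBall, dist_zero_right]
      have : 0 ≤ ‖T‖ := norm_nonneg _
      have := abs_nonneg r
      linarith)
    simpa using this
  rw [htx]
  obtain ⟨ρ, hρ⟩ := exists_nat_ge (‖x‖ + (‖T'‖ * |r| + |c|) + |r| + 1)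
  have h0 : Tendsto (fun k => a ρ - v ρ k) (hyperfilter ℕ : Filter ℕ) (𝓝 0) := by
    simpa using (ha ρ).const_sub (a ρ)
  have hT0 : Tendsto (fun k => t + L x + T (a ρ - v ρ k)) (hyperfilter ℕ : Filter ℕ)
      (𝓝 (t + L x)) := by
    simpa using ((T.continuous.tendsto 0).comp h0).const_add (t + L x)
  refine eq_of_tendsto_of_frequently_patchEq hV hT0 tendsto_const_nhds (Eventually.frequently ?_)
  have hlarge : ∀ᶠ k : ℕ in (hyperfilter ℕ : Filter ℕ), ‖L x‖ + ‖T‖ + |r| ≤ k := by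
    apply Filter.Eventually.filter_mono (Nat.hyperfilter_le_atTop)
    exact (tendsto_natCast_atTop_atTop (R := ℝ)).eventually_ge_atTop _
  filter_upwards [hlarge, hAP' ρ, h0.eventually_mem (closedBall_mem_nhds 0 one_pos)]
    with k hk hAk hek u hu
  have hek' : ‖a ρ - v ρ k‖ ≤ 1 := by simpa using hek
  have hur : ‖u‖ ≤ |r| := (hr' u hu).trans (le_abs_self r)
  have hTe : ‖T (a ρ - v ρ k)‖ ≤ ‖T‖ := T.le_opNorm_of_le hek' |>.trans (by simp)
  have hnorm : ‖L x + T (a ρ - v ρ k) + u‖ ≤ ‖L x‖ + ‖T‖ + |r| :=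
    norm_add₃_le.trans (by gcongr)
  have h1 := ht (L x + T (a ρ - v ρ k) + u) (by simpa using hnorm)
  have h2 := hy k (L x + T (a ρ - v ρ k) + u) (by simpa using hnorm.trans hk)
  have h3 : P (t + L x + T (a ρ - v ρ k) + u) = P (y k + (L x + T (a ρ - v ρ k) + u)) := by
    rw [← h2, h1]; congr 1; abel
  rw [h3]
  have hLu : ‖L.symm u‖ ≤ ‖T'‖ * |r| := T'.le_opNorm_of_le hur
  have h4 := hc (L.symm (y k) + (a ρ - v ρ k) + (x + L.symm u)) (z' + L.symm u) fun q hq => ?_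
  · simp only [map_add, LinearEquiv.apply_symm_apply] at h4
    rw [← h4]
    congr 1
    change y k + (L x + L (a ρ - v ρ k) + u) = _
    abel
  · have hqc : ‖q‖ ≤ |c| := le_trans (by simpa using hq) (le_abs_self c)
    have hn1 : ‖L.symm u + q‖ ≤ ‖T'‖ * |r| + |c| :=
      (norm_add_le _ _).trans (by gcongr)
    have hn2 := norm_add_le x (L.symm u + q)
    have := le_abs_self r
    have := abs_nonneg r
    rw [add_assoc z', ← hz' (L.symm u + q) (by simpa using hn1),
      hAk _ (by linarith) (by linarith)]
    congr 1
    abel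

/-- A sequence of iterated predecessors of `P`, all obeying a common subdivision rule. -/
structure IsPredecessorChain (L : E ≃ₗ[ℝ] E) (P P' : E → S) (c : ℝ) (p : ℕ → E → S) : Prop where
  zero : p 0 = P
  one : p 1 = P'
  liFrom : ∀ n, LIfrom (p n) P
  rule : ∀ (n m : ℕ) (x y : E), PatchEq (p (n + 1)) (p (m + 1)) x y (closedBall 0 c) →
    p n (L x) = p m (L y)

theorem exists_isPredecessorChain [FiniteDimensional ℝ E] (L : E ≃ₗ[ℝ] E) {P P' : E → S}
    (hFLC : IsFLC P) (hWS : WellSeparated P) (hsub : IsLSub L P P') :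
    ∃ (c : ℝ) (p : ℕ → E → S), 0 ≤ c ∧ IsPredecessorChain L P P' c p := by
  have : ProperSpace E := FiniteDimensional.proper_real E
  obtain ⟨c, hc0, hc⟩ := hsub.exists_radius
  choose pred hpred using fun Q : {Q : E → S // LIfrom Q P'} =>
    exists_predecessor L hFLC hWS hsub.1 hc (Q.2.trans hsub.1)
  let A : ℕ → {Q : E → S // LIfrom Q P'} := fun n =>
    Nat.rec ⟨P', LIfrom.refl P'⟩ (fun _ Q => ⟨pred Q, (hpred Q).1⟩) n
  let p : ℕ → E → S := fun n => Nat.casesOn n P fun k => (A k).1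
  have hrule : ∀ (n : ℕ) (x y : E), PatchEq (p (n + 1)) P' x y (closedBall 0 c) →
      p n (L x) = P (L y) := by
    intro n
    cases n with
    | zero => exact hc
    | succ n => exact (hpred (A n)).2
  refine ⟨c, p, hc0, rfl, rfl, fun n => ?_, fun n m x y hxy => ?_⟩
  · cases n with
    | zero => exact LIfrom.refl P
    | succ n => exact (A n).2.trans hsub.1
  · obtain ⟨z, hz⟩ := (A n).2 (closedBall 0 c) (isCompact_closedBall _ _) x
    rw [hrule n x z hz, hrule m y z fun u hu => (hxy u hu).symm.trans (hz u hu)]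

/-- The inverse powers of an expansive map are uniformly contracting. -/
theorem IsExpansive.norm_symm_le {L : E ≃ₗ[ℝ] E} (hL : IsExpansive L) :
    ∃ C > (0 : ℝ), ∃ r : ℝ, 0 < r ∧ r < 1 ∧
      ∀ (n : ℕ) (x : E), ‖(L ^ n : E ≃ₗ[ℝ] E).symm x‖ ≤ C * r ^ n * ‖x‖ := by
  obtain ⟨C, hC, l, hl, h⟩ := hL
  have hl0 : 0 < l := one_pos.trans hl
  refine ⟨C⁻¹, inv_pos.2 hC, l⁻¹, inv_pos.2 hl0, inv_lt_one_of_one_lt₀ hl, fun n x => ?_⟩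
  have := h n ((L ^ n : E ≃ₗ[ℝ] E).symm x)
  rw [LinearEquiv.apply_symm_apply] at this
  rw [inv_pow, ← mul_inv, ← div_eq_inv_mul, le_div_iff₀ (by positivity)]
  linarith

/-- The inverse powers of an expansive map eventually contract any ball into the unit ball. -/
theorem IsExpansive.exists_norm_symm_le_one {L : E ≃ₗ[ℝ] E} (hL : IsExpansive L) (ρ : ℝ) :
    ∃ N : ℕ, ∀ n ≥ N, ∀ x : E, ‖x‖ ≤ ρ → ‖(L ^ n : E ≃ₗ[ℝ] E).symm x‖ ≤ 1 := by
  obtain ⟨C, hC, r, hr0, hr1, h⟩ := hL.norm_symm_le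
  have ht : Tendsto (fun n : ℕ => C * r ^ n * |ρ|) atTop (𝓝 0) := by
    simpa using ((tendsto_pow_atTop_nhds_zero_of_lt_one hr0.le hr1).const_mul C).mul_const |ρ|
  obtain ⟨N, hN⟩ := eventually_atTop.1 (ht.eventually_le_const one_pos)
  refine ⟨N, fun n hn x hx => (h n x).trans (le_trans ?_ (hN n hn))⟩
  gcongr
  exact hx.trans (le_abs_self ρ)

/-- Powers of a linear automorphism of a finite-dimensional space are bounded. -/
theorem exists_norm_pow_apply_le [FiniteDimensional ℝ E] (L : E ≃ₗ[ℝ] E) (n : ℕ) :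
    ∃ M > (0 : ℝ), ∀ x : E, ‖(L ^ n : E ≃ₗ[ℝ] E) x‖ ≤ M * ‖x‖ := by
  let T := LinearMap.toContinuousLinearMap ((L ^ n : E ≃ₗ[ℝ] E) : E →ₗ[ℝ] E)
  refine ⟨‖T‖ + 1, by positivity, fun x => (T.le_opNorm x).trans ?_⟩
  gcongr
  linarith

namespace IsPredecessorChain

variable {L : E ≃ₗ[ℝ] E} {P P' : E → S} {c : ℝ} {p : ℕ → E → S}

/-- All iterated subdivision rules of an expansive chain are local with a common radius. -/
theorem exists_iterated_rule (hp : IsPredecessorChain L P P' c p) (hc : 0 ≤ c)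
    (hL : IsExpansive L) :
    ∃ d : ℝ, 0 ≤ d ∧ ∀ (j n m : ℕ) (x y : E),
      PatchEq (p (n + j)) (p (m + j)) x y (closedBall 0 d) →
        p n ((L ^ j : E ≃ₗ[ℝ] E) x) = p m ((L ^ j : E ≃ₗ[ℝ] E) y) := by
  obtain ⟨C, hC, r, hr0, hr1, hsymm⟩ := hL.norm_symm_le
  have hr : 0 < 1 - r := by linarith
  set D := C * c / (1 - r) with hD
  have hD0 : 0 ≤ D := by positivity
  have hDr : D * (1 - r) = C * c := by rw [hD]; field_simp
  suffices key : ∀ (j n m : ℕ) (x y : E),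
      PatchEq (p (n + j)) (p (m + j)) x y (closedBall 0 (D * (1 - r ^ j))) →
        p n ((L ^ j : E ≃ₗ[ℝ] E) x) = p m ((L ^ j : E ≃ₗ[ℝ] E) y) by
    refine ⟨D, hD0, fun j n m x y h => key j n m x y fun u hu => h u ?_⟩
    refine closedBall_subset_closedBall ?_ hu
    have : 0 ≤ r ^ j := by positivity
    nlinarith
  intro j
  induction j with
  | zero =>
    intro n m x y h
    simpa using h 0 (by simp)
  | succ j ih =>
    intro n m x y h
    rw [pow_succ']
    refine hp.rule n m _ _ fun u hu => ?_
    have hu' : ‖(L ^ j : E ≃ₗ[ℝ] E).symm u‖ ≤ D * (1 - r ^ (j + 1)) - D * (1 - r ^ j) :=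
      calc ‖(L ^ j : E ≃ₗ[ℝ] E).symm u‖ ≤ C * r ^ j * ‖u‖ := hsymm j u
        _ ≤ C * r ^ j * c := by
          gcongr
          simpa using hu
        _ = (C * c) * r ^ j := by ring
        _ = D * (1 - r ^ (j + 1)) - D * (1 - r ^ j) := by rw [← hDr]; ring
    have := ih (n + 1) (m + 1) (x + (L ^ j : E ≃ₗ[ℝ] E).symm u)
      (y + (L ^ j : E ≃ₗ[ℝ] E).symm u) fun q hq => by
        have hq' : ‖q‖ ≤ D * (1 - r ^ j) := by simpa using hq
        have hn := norm_add_le ((L ^ j : E ≃ₗ[ℝ] E).symm u) q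
        rw [show n + 1 + j = n + (j + 1) by lia, show m + 1 + j = m + (j + 1) by lia, add_assoc,
          add_assoc]
        refine h _ ?_
        simp only [mem_closedBall, dist_zero_right]
        linarith
    simpa using this

end IsPredecessorChain

/-- All patches of radius `r` of patterns locally indistinguishable from an FLC pattern `P` occur
in `P` at positions in a fixed compact set. -/
theorem IsFLC.exists_isCompact_of_liFrom [FiniteDimensional ℝ E] {P : E → S} (hFLC : IsFLC P)
    (r : ℝ) :
    ∃ K : Set E, IsCompact K ∧
      ∀ Q : E → S, LIfrom Q P → ∀ x : E, ∃ v ∈ K, PatchEq Q P x v (closedBall 0 r) := by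
  have : ProperSpace E := FiniteDimensional.proper_real E
  obtain ⟨K, hK, h⟩ := hFLC (closedBall 0 r) (isCompact_closedBall _ _)
  refine ⟨K, hK, fun Q hQ x => ?_⟩
  obtain ⟨y, hy⟩ := hQ (closedBall 0 r) (isCompact_closedBall _ _) x
  obtain ⟨v, hvK, hv⟩ := h y
  exact ⟨v, hvK, fun u hu => (hy u hu).trans (hv u hu)⟩

/-- Patches of `Q` and `Q'` that both occur in `P`, at nearby positions, agree up to the
corresponding small translation. -/
theorem PatchEq.of_near {P Q Q' : E → S} {x y a b : E} {r s : ℝ}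
    (h : PatchEq Q P x a (closedBall 0 r)) (h' : PatchEq Q' P y b (closedBall 0 r))
    (hab : ‖a - b‖ ≤ 1) (hs : s + 1 ≤ r) :
    PatchEq Q Q' x (y + (a - b)) (closedBall 0 s) := by
  intro u hu
  have hu' : ‖u‖ ≤ s := by simpa using hu
  have hn := norm_add_le (a - b) u
  rw [h u (by simp only [mem_closedBall, dist_zero_right]; linarith), add_assoc y,
    h' _ (by simp only [mem_closedBall, dist_zero_right]; linarith)]
  congr 1
  abel

/-- Any infinite set of indices has a finite subset in which every pair of sequences in a compact
set has two indices along which both sequences are nearly constant. -/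
theorem exists_finset_near {K : Set E} (hK : IsCompact K) {I : Set ℕ} (hI : I.Infinite) {η : ℝ}
    (hη : 0 < η) :
    ∃ F : Finset ℕ, (∀ n ∈ F, n ∈ I) ∧ ∀ a b : ℕ → E, (∀ n, a n ∈ K) → (∀ n, b n ∈ K) →
      ∃ n ∈ F, ∃ m ∈ F, n < m ∧ ‖a n - a m‖ ≤ η ∧ ‖b n - b m‖ ≤ η := by
  obtain ⟨t, htf, ht⟩ := Metric.totallyBounded_iff.1 hK.totallyBounded (η / 2) (by positivity)
  lift t to Finset E using htf
  obtain ⟨F, hFI, hF⟩ := hI.exists_subset_card_eq ((t ×ˢ t).card + 1)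
  refine ⟨F, fun n hn => hFI hn, fun a b ha hb => ?_⟩
  have hcover : ∀ x ∈ K, ∃ y ∈ t, dist x y < η / 2 := fun x hx => by simpa using ht hx
  choose α hα hα' using fun n => hcover _ (ha n)
  choose β hβ hβ' using fun n => hcover _ (hb n)
  have hnear : ∀ {u v y : E}, dist u y < η / 2 → dist v y < η / 2 → ‖u - v‖ ≤ η := by
    intro u v y hu hv
    rw [← dist_eq_norm]
    linarith [dist_triangle_right u v y]
  obtain ⟨n, hn, m, hm, hne, heq⟩ := Finset.exists_ne_map_eq_of_card_lt_of_maps_to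
    (s := F) (t := t ×ˢ t) (f := fun n => (α n, β n)) (by lia)
    (fun n _ => Finset.mem_coe.2 (Finset.mem_product.2 ⟨hα n, hβ n⟩))
  simp only [Prod.mk.injEq] at heq
  have h1 := hα' n
  have h2 := hβ' n
  rw [heq.1] at h1
  rw [heq.2] at h2
  rcases hne.lt_or_gt with h | h
  · exact ⟨n, hn, m, hm, h, hnear h1 (hα' m), hnear h2 (hβ' m)⟩
  · exact ⟨m, hm, n, hn, h, hnear (hα' m) h1, hnear (hβ' m) h2⟩

/-- A sequence in a compact set has an infinite set of indices along which its terms are pairwise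
at distance at most `1`. -/
theorem exists_infinite_near {K : Set E} (hK : IsCompact K) {a : ℕ → E} (ha : ∀ n, a n ∈ K) :
    ∃ I : Set ℕ, I.Infinite ∧ ∀ n ∈ I, ∀ m ∈ I, ‖a n - a m‖ ≤ 1 := by
  obtain ⟨t, htf, ht⟩ := Metric.totallyBounded_iff.1 hK.totallyBounded (1 / 2) (by positivity)
  have : Finite t := htf
  have hcover : ∀ n, ∃ y : t, dist (a n) y < 1 / 2 := fun n => by simpa using ht (ha n)
  choose α hα using hcover
  obtain ⟨y, hy⟩ := Finite.exists_infinite_fiber α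
  refine ⟨α ⁻¹' {y}, Set.infinite_coe_iff.1 hy, fun n hn m hm => ?_⟩
  have h1 := hα n
  have h2 := hα m
  rw [show α n = y from hn] at h1
  rw [show α m = y from hm] at h2
  rw [← dist_eq_norm]
  linarith [dist_triangle_right (a n) (a m) (y : E)]

namespace IsPredecessorChain

variable {L : E ≃ₗ[ℝ] E} {P P' : E → S} {c : ℝ} {p : ℕ → E → S}

/-- A short local period at level `i + q` is a global period, provided the `i`-th predecessor
recurs around the origin of the `(i + q)`-th one, and level `i` is large enough to exhibit all
patches of `P` of a suitable size. -/
theorem mem_periods_of_local (hp : IsPredecessorChain L P P' c p) {d κ : ℝ}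
    (hd0 : 0 ≤ d)
    (hd : ∀ (j n m : ℕ) (x y : E), PatchEq (p (n + j)) (p (m + j)) x y (closedBall 0 d) →
      p n ((L ^ j : E ≃ₗ[ℝ] E) x) = p m ((L ^ j : E ≃ₗ[ℝ] E) y))
    (hκ : ∀ Q : E → S, LIfrom Q P → ∀ x : E,
      ∃ v : E, ‖v‖ ≤ κ ∧ PatchEq Q P x v (closedBall 0 (d + 1)))
    {i q : ℕ} (hi : ∀ x : E, ‖x‖ ≤ κ + d + 1 → ‖(L ^ i : E ≃ₗ[ℝ] E).symm x‖ ≤ 1)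
    {D : E} (hD : ‖D‖ ≤ 1) (hrec : PatchEq (p i) (p (i + q)) 0 D (closedBall 0 (d + 1)))
    {h : E} (hh : ‖(L ^ i : E ≃ₗ[ℝ] E) h‖ ≤ 1)
    (hloc : ∀ z : E, ‖z‖ ≤ 2 →
      P ((L ^ (i + q) : E ≃ₗ[ℝ] E) (z + h)) = P ((L ^ (i + q) : E ≃ₗ[ℝ] E) z)) :
    (L ^ (i + q) : E ≃ₗ[ℝ] E) h ∈ periods P := by
  have hball : ∀ {u : E} {r : ℝ}, ‖u‖ ≤ r → u ∈ closedBall (0 : E) r := fun h => by simpa using h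
  have hpow : ∀ x, (L ^ (i + q) : E ≃ₗ[ℝ] E) x =
      (L ^ q : E ≃ₗ[ℝ] E) ((L ^ i : E ≃ₗ[ℝ] E) x) := fun x => by
    rw [add_comm, pow_add, LinearEquiv.mul_apply]
  have hPq : ∀ z : E, ‖z‖ ≤ 1 →
      P ((L ^ i : E ≃ₗ[ℝ] E) z) = p q ((L ^ i : E ≃ₗ[ℝ] E) (D + z)) := by
    intro z hz
    rw [← hp.zero]
    refine hd i 0 q _ _ fun u hu => ?_
    have hu' : ‖u‖ ≤ d := by simpa using hu
    have := hrec (z + u) (hball ((norm_add_le _ _).trans (by linarith)))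
    rw [zero_add, ← add_assoc, add_comm i q] at this
    rwa [zero_add]
  have hmain : ∀ Y : E, P ((L ^ q : E ≃ₗ[ℝ] E) Y + (L ^ (i + q) : E ≃ₗ[ℝ] E) h) =
      P ((L ^ q : E ≃ₗ[ℝ] E) Y) := by
    intro Y
    obtain ⟨v, hvκ, hv⟩ := hκ (p q) (hp.liFrom q) Y
    set v' := (L ^ i : E ≃ₗ[ℝ] E).symm v with hv'
    have hcopy : PatchEq (p q) (p q) Y ((L ^ i : E ≃ₗ[ℝ] E) (D + v')) (closedBall 0 (d + 1)) := by
      intro u hu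
      have hu' : ‖u‖ ≤ d + 1 := by simpa using hu
      have := hPq ((L ^ i : E ≃ₗ[ℝ] E).symm (v + u))
        (hi _ ((norm_add_le _ _).trans (by linarith)))
      rw [hv u hu]
      simpa [hv', add_assoc] using this
    have htransfer : ∀ t : E, ‖t‖ ≤ 1 → P ((L ^ q : E ≃ₗ[ℝ] E) (Y + t)) =
        P ((L ^ q : E ≃ₗ[ℝ] E) ((L ^ i : E ≃ₗ[ℝ] E) (D + v') + t)) := by
      intro t ht
      rw [← hp.zero]
      refine hd q 0 0 _ _ fun u hu => ?_
      have hu' : ‖u‖ ≤ d := by simpa using hu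
      rw [zero_add, add_assoc, add_assoc]
      exact hcopy _ (hball ((norm_add_le _ _).trans (by linarith)))
    have hDv : ‖D + v'‖ ≤ 2 := by
      have : ‖v'‖ ≤ 1 := hi v (by linarith)
      exact (norm_add_le _ _).trans (by linarith)
    have h0 := htransfer 0 (by simp)
    have h1 := htransfer _ hh
    rw [← map_add (L ^ i), ← hpow, hloc _ hDv, hpow] at h1
    rw [hpow, ← map_add, h1]
    simpa using h0.symm
  intro x
  simpa using hmain ((L ^ q : E ≃ₗ[ℝ] E).symm x)

end IsPredecessorChain

/-- Theorem: every FLC, well-separated, expansive `L`-sub pattern satisfies property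
`P_f` for some function `f`. -/
theorem stmt8 [FiniteDimensional ℝ E] (L : E ≃ₗ[ℝ] E) (hL : IsExpansive L)
    (P P' : E → S) (hFLC : IsFLC P) (hWS : WellSeparated P) (hsub : IsLSub L P P') :
    ∃ f : ℝ → ℝ, (∀ R : ℝ, 0 ≤ R → 0 ≤ f R) ∧
      ∀ (x : E) (R : ℝ), 0 ≤ R → PatchEq P P 0 x (closedBall 0 (f R)) →
        ∃ g ∈ periods P,
          PatchEq P' P' 0 (L.symm x + L.symm g) (closedBall 0 R) := by
  obtain ⟨c, p, hc, hp⟩ := exists_isPredecessorChain L hFLC hWS hsub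
  obtain ⟨d, hd0, hd⟩ := hp.exists_iterated_rule hc hL
  obtain ⟨K, hKc, hK⟩ := hFLC.exists_isCompact_of_liFrom (d + 7)
  obtain ⟨K', hKc', hK'⟩ := hFLC.exists_isCompact_of_liFrom (d + 1)
  obtain ⟨κ, hκ⟩ := hKc'.isBounded.subset_closedBall (0 : E)
  have hball : ∀ {u : E} {r : ℝ}, ‖u‖ ≤ r → u ∈ closedBall (0 : E) r := fun h => by simpa using h
  choose a haK ha using fun n => hK (p n) (hp.liFrom n) 0
  obtain ⟨I, hI, hIa⟩ := exists_infinite_near hKc haK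
  suffices key : ∀ R : ℝ, ∃ s : ℝ, 0 ≤ s ∧ ∀ x : E, PatchEq P P 0 x (closedBall 0 s) →
      ∃ g ∈ periods P, PatchEq P' P' 0 (L.symm x + L.symm g) (closedBall 0 R) by
    choose f hf hf' using key
    exact ⟨f, fun R _ => hf R, fun x R _ => hf' R x⟩
  intro R
  obtain ⟨N, hN⟩ := hL.exists_norm_symm_le_one (|κ| + d + 1 + |R|)
  have hκd : ∀ n ≥ N, ∀ x : E, ‖x‖ ≤ κ + d + 1 → ‖(L ^ n : E ≃ₗ[ℝ] E).symm x‖ ≤ 1 :=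
    fun n hn x hx => hN n hn x (by linarith [le_abs_self κ, abs_nonneg R])
  obtain ⟨i, hiI, hiN⟩ := hI.exists_gt N
  obtain ⟨M, hM0, hM⟩ := exists_norm_pow_apply_le L i
  obtain ⟨F, hFI, hF⟩ := exists_finset_near hKc (hI.sdiff (Set.finite_Iic i))
    (η := min 1 (1 / (2 * M))) (by positivity)
  choose B hB0 hB using exists_norm_pow_apply_le L
  have hs0 : 0 ≤ ∑ n ∈ F, B n * 6 := Finset.sum_nonneg fun n _ => by
    have := hB0 n
    positivity
  refine ⟨∑ n ∈ F, B n * 6, hs0, fun x hx => ?_⟩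
  have hPx : ∀ n ∈ F, ∀ z : E, ‖z‖ ≤ 6 →
      P (x + (L ^ n : E ≃ₗ[ℝ] E) z) = P ((L ^ n : E ≃ₗ[ℝ] E) z) := by
    intro n hn z hz
    have hle : B n * 6 ≤ ∑ n ∈ F, B n * 6 := Finset.single_le_sum
      (f := fun n => B n * 6) (fun k _ => by have := hB0 k; positivity) hn
    have hz' : ‖(L ^ n : E ≃ₗ[ℝ] E) z‖ ≤ B n * 6 :=
      (hB n z).trans (by have := hB0 n; gcongr)
    simpa using (hx _ (hball (hz'.trans hle))).symm
  choose b hbK hb using fun n =>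
    hK (p n) (hp.liFrom n) ((L ^ n : E ≃ₗ[ℝ] E).symm x)
  obtain ⟨n, hnF, m, hmF, hnm, han, hbn⟩ := hF a b haK hbK
  have hin : i < n := by simpa using (hFI n hnF).2
  have hane := han.trans (min_le_left _ _)
  have hbne := hbn.trans (min_le_left _ _)
  set u := a n - a m with hu
  set v := b n - b m with hv
  obtain ⟨q, rfl⟩ : ∃ q, m = n + (q + 1) := ⟨m - n - 1, by lia⟩
  have hpow : ∀ (j k : ℕ) (x : E), (L ^ (j + k) : E ≃ₗ[ℝ] E) x =
      (L ^ j : E ≃ₗ[ℝ] E) ((L ^ k : E ≃ₗ[ℝ] E) x) := fun j k x => by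
    rw [pow_add, LinearEquiv.mul_apply]
  -- The level-`(q + 1)` predecessor looks the same around two positions differing by `v - u`.
  have hlevel : ∀ z : E, ‖z‖ ≤ 6 → p (q + 1) ((L ^ n : E ≃ₗ[ℝ] E) (u + z)) =
      p (q + 1) ((L ^ (q + 1) : E ≃ₗ[ℝ] E).symm x + (L ^ n : E ≃ₗ[ℝ] E) (v + z)) := by
    intro z hz
    have h1 : p 0 ((L ^ n : E ≃ₗ[ℝ] E) z) = p (q + 1) ((L ^ n : E ≃ₗ[ℝ] E) (u + z)) := by
      refine hd n 0 (q + 1) _ _ fun t ht => ?_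
      have ht' : ‖t‖ ≤ d := by simpa using ht
      have := (ha n).of_near (ha (n + (q + 1))) hane (s := d + 6) (by linarith) (z + t)
        (hball ((norm_add_le _ _).trans (by linarith)))
      simpa [add_comm, add_left_comm, add_assoc] using this
    have h2 : p 0 ((L ^ n : E ≃ₗ[ℝ] E) ((L ^ n : E ≃ₗ[ℝ] E).symm x + z)) = p (q + 1)
        ((L ^ n : E ≃ₗ[ℝ] E) ((L ^ (n + (q + 1)) : E ≃ₗ[ℝ] E).symm x + (v + z))) := by
      refine hd n 0 (q + 1) _ _ fun t ht => ?_
      have ht' : ‖t‖ ≤ d := by simpa using ht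
      have := (hb n).of_near (hb (n + (q + 1))) hbne (s := d + 6) (by linarith) (z + t)
        (hball ((norm_add_le _ _).trans (by linarith)))
      rw [zero_add, add_comm (q + 1) n]
      simpa only [add_assoc] using this
    have h3 : (L ^ n : E ≃ₗ[ℝ] E) ((L ^ (n + (q + 1)) : E ≃ₗ[ℝ] E).symm x) =
        (L ^ (q + 1) : E ≃ₗ[ℝ] E).symm x := by
      apply (L ^ (q + 1) : E ≃ₗ[ℝ] E).injective
      rw [← hpow, add_comm (q + 1) n, LinearEquiv.apply_symm_apply, LinearEquiv.apply_symm_apply]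
    rw [map_add _ _ (v + z), h3, map_add, LinearEquiv.apply_symm_apply, hp.zero,
      hPx n hnF z hz] at h2
    rw [← h1, ← h2, hp.zero]
  -- Subdividing `k` times, with `k + l = q + 1`.
  have hsubdiv : ∀ k l : ℕ, l + k = q + 1 → ∀ z : E, ‖z‖ ≤ 5 →
      p l ((L ^ (k + n) : E ≃ₗ[ℝ] E) (u + z)) =
        p l ((L ^ l : E ≃ₗ[ℝ] E).symm x + (L ^ (k + n) : E ≃ₗ[ℝ] E) (v + z)) := by
    intro k l hkl z hz
    have hsymm : (L ^ k : E ≃ₗ[ℝ] E) ((L ^ (q + 1) : E ≃ₗ[ℝ] E).symm x) =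
        (L ^ l : E ≃ₗ[ℝ] E).symm x := by
      apply (L ^ l : E ≃ₗ[ℝ] E).injective
      rw [← hpow, hkl, LinearEquiv.apply_symm_apply, LinearEquiv.apply_symm_apply]
    rw [hpow, hpow, ← hsymm, ← map_add (L ^ k)]
    refine hd k l l _ _ fun t ht => ?_
    have ht' : ‖t‖ ≤ d := by simpa using ht
    have ht1 : ‖(L ^ n : E ≃ₗ[ℝ] E).symm t‖ ≤ 1 :=
      hN n (by lia) t (by linarith [abs_nonneg κ, abs_nonneg R])
    have := hlevel (z + (L ^ n : E ≃ₗ[ℝ] E).symm t) ((norm_add_le _ _).trans (by linarith))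
    rw [hkl]
    simpa only [map_add, LinearEquiv.apply_symm_apply, ← add_assoc] using this
  have hm_eq : q + 1 + n = n + (q + 1) := by lia
  have hlocal : ∀ z : E, ‖z‖ ≤ 2 → P ((L ^ (n + (q + 1)) : E ≃ₗ[ℝ] E) (z + (v - u))) =
      P ((L ^ (n + (q + 1)) : E ≃ₗ[ℝ] E) z) := by
    intro z hz
    have hzu : ‖z - u‖ ≤ 3 := (norm_sub_le _ _).trans (by linarith)
    have := hsubdiv (q + 1) 0 (by lia) (z - u) (by linarith)
    rw [hp.zero, hm_eq, add_sub_cancel, pow_zero] at this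
    rw [this]
    refine (Eq.trans ?_ (hPx _ hmF (v + (z - u)) ((norm_add_le _ _).trans (by linarith))).symm)
    congr 2
    abel
  have hper : (L ^ (n + (q + 1)) : E ≃ₗ[ℝ] E) (v - u) ∈ periods P := by
    obtain ⟨k, hk⟩ : ∃ k, n + (q + 1) = i + k := ⟨n + (q + 1) - i, by lia⟩
    rw [hk] at hlocal ⊢
    have hmI := (hFI _ hmF).1
    have hrec := (ha i).of_near (ha _) (hIa i hiI _ hmI) (s := d + 1) (by linarith)
    rw [hk, zero_add] at hrec
    refine hp.mem_periods_of_local hd0 hd (fun Q hQ y => ?_) (hκd i hiN.le)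
      (by rw [← hk]; exact hIa i hiI _ hmI) hrec ?_ hlocal
    · obtain ⟨w, hw, hw'⟩ := hK' Q hQ y
      exact ⟨w, by simpa using hκ hw, hw'⟩
    · have h1 := han.trans (min_le_right _ _)
      have h2 := hbn.trans (min_le_right _ _)
      calc ‖(L ^ i : E ≃ₗ[ℝ] E) (v - u)‖ ≤ M * ‖v - u‖ := hM _
        _ ≤ M * (1 / (2 * M) + 1 / (2 * M)) := by
          gcongr
          exact (norm_sub_le _ _).trans (by gcongr)
        _ = 1 := by field_simp; norm_num
  refine ⟨_, hper, fun y hy => ?_⟩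
  have hyR : ‖y‖ ≤ |R| := le_trans (by simpa using hy) (le_abs_self R)
  have hy1 : ‖(L ^ (q + n) : E ≃ₗ[ℝ] E).symm y‖ ≤ 1 :=
    hN _ (by lia) y (by linarith [abs_nonneg κ])
  have := hsubdiv q 1 (by lia) ((L ^ (q + n) : E ≃ₗ[ℝ] E).symm y - u)
    ((norm_sub_le _ _).trans (by linarith))
  rw [hp.one, add_sub_cancel, LinearEquiv.apply_symm_apply, pow_one] at this
  rw [zero_add, this]
  congr 1
  have hLw : L.symm ((L ^ (n + (q + 1)) : E ≃ₗ[ℝ] E) (v - u)) =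
      (L ^ (q + n) : E ≃ₗ[ℝ] E) (v - u) := by
    rw [LinearEquiv.symm_apply_eq, show n + (q + 1) = 1 + (q + n) by lia, hpow, pow_one]
  rw [hLw, show v + ((L ^ (q + n) : E ≃ₗ[ℝ] E).symm y - u) =
    (v - u) + (L ^ (q + n) : E ≃ₗ[ℝ] E).symm y by abel, map_add, LinearEquiv.apply_symm_apply,
    add_assoc]
end

section
/- Let P be an FLC, well-separated, expansive L-sub pattern with predecessor P' and hierarchy (P_i)_{i∈ℤ} (so σ(P_{i+1}) = P_i, P₀ = P, P₁ = P'). (i) If X ⊆ E is such that for every y ∈ E there exists x ∈ X with P[x,V⁰] = P[y,V⁰], then for every k ∈ ℕ₀ and y ∈ E there exists x ∈ L^k X with P_{−k}[x,V^k] = P_{−k}[y,V^k]. (ii) If P is primitive, then there exists n ∈ ℕ₀ such that for all k ∈ ℕ₀ and all x, y ∈ E there exists v ∈ V^{k+n} with P[x,V^k] = P[y+v,V^k]; in particular, P is repetitive. -/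
open Metric Set Filter Topology Pointwise

variable {E : Type*} [NormedAddCommGroup E] [NormedSpace ℝ E] {S : Type*}

/-- The modified level-`k` balls `V^k := L^k B₁ + B_κ`. -/
def Vk (L : E ≃ₗ[ℝ] E) (κ : ℝ) (k : ℕ) : Set E :=
  ⇑(L ^ k) '' closedBall 0 1 + closedBall 0 κ


theorem vk_succ_add_subset (L : E ≃ₗ[ℝ] E) (κ c : ℝ)
    (hκ : ∀ X : Set E,
      ⇑L '' X + closedBall 0 κ + closedBall 0 c ⊆ ⇑L '' (X + closedBall 0 κ)) (k : ℕ) :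
    Vk L κ (k + 1) + closedBall 0 c ⊆ ⇑L '' Vk L κ k := by
  have h : ⇑(L ^ (k + 1)) '' closedBall 0 1 = ⇑L '' (⇑(L ^ k) '' closedBall 0 1) := by
    rw [Set.image_image]
    refine Set.image_congr fun x _ => ?_
    rw [pow_succ']
    rfl
  rw [Vk, h]
  exact hκ _

theorem patchEq_substMap (L : E ≃ₗ[ℝ] E) {κ c : ℝ}
    (hκ : ∀ X : Set E,
      ⇑L '' X + closedBall 0 κ + closedBall 0 c ⊆ ⇑L '' (X + closedBall 0 κ))
    {Ω : Set (E → S)} {Sub : (E → S) → (E → S)}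
    (hSub : ∀ Q ∈ distort L '' Ω, ∀ R ∈ distort L '' Ω,
      ∀ x y : E, PatchEq Q R x y (closedBall 0 c) → Sub Q x = Sub R y)
    {Q R : E → S} (hQ : Q ∈ Ω) (hR : R ∈ Ω) {x y : E} {k : ℕ}
    (h : PatchEq Q R x y (Vk L κ k)) :
    PatchEq (substMap L Sub Q) (substMap L Sub R) (L x) (L y) (Vk L κ (k + 1)) := by
  intro u hu
  refine hSub _ (mem_image_of_mem _ hQ) _ (mem_image_of_mem _ hR) _ _ fun w hw => ?_
  obtain ⟨t, ht, htu⟩ := vk_succ_add_subset L κ c hκ k (Set.add_mem_add hu hw)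
  simp only [distort, add_assoc, ← htu, ← map_add, LinearEquiv.symm_apply_apply]
  exact h t ht

theorem patchEq_hierarchy (L : E ≃ₗ[ℝ] E) {κ c : ℝ}
    (hκ : ∀ X : Set E,
      ⇑L '' X + closedBall 0 κ + closedBall 0 c ⊆ ⇑L '' (X + closedBall 0 κ))
    {Ω : Set (E → S)} {Sub : (E → S) → (E → S)}
    (hSub : ∀ Q ∈ distort L '' Ω, ∀ R ∈ distort L '' Ω,
      ∀ x y : E, PatchEq Q R x y (closedBall 0 c) → Sub Q x = Sub R y)
    {Pseq : ℤ → E → S} (hmem : ∀ i : ℤ, Pseq i ∈ Ω)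
    (hσ : ∀ i : ℤ, substMap L Sub (Pseq (i + 1)) = Pseq i)
    {i : ℤ} {x y : E} (h : PatchEq (Pseq i) (Pseq i) x y (Vk L κ 0)) (k : ℕ) :
    PatchEq (Pseq (i - k)) (Pseq (i - k)) ((L ^ k) x) ((L ^ k) y) (Vk L κ k) := by
  induction k with
  | zero => simpa using h
  | succ k ih =>
    have hs := patchEq_substMap L hκ hSub (hmem _) (hmem _) ih
    rw [show i - (k : ℤ) = i - ((k + 1 : ℕ) : ℤ) + 1 by push_cast; ring, hσ] at hs
    rw [pow_succ']
    exact hs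

theorem LIfrom.exists_patchEq_add {P Q : E → S} (hQ : LIfrom Q P) {X V : Set E}
    (hX : IsCompact X) (hV : IsCompact V)
    (h : ∀ x y : E, ∃ z ∈ X, PatchEq P P x (y + z) V) (x y : E) :
    ∃ z ∈ X, PatchEq Q Q x (y + z) V := by
  obtain ⟨w, hw⟩ := hQ (V ∪ ({y - x} + X + V))
    (hV.union ((isCompact_singleton.add hX).add hV)) x
  obtain ⟨z, hz, hzw⟩ := h w (w + (y - x))
  refine ⟨z, hz, fun u hu => ?_⟩
  have h₁ := hw u (Or.inl hu)
  have h₂ := hw (y - x + z + u)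
    (Or.inr (Set.add_mem_add (Set.add_mem_add (mem_singleton _) hz) hu))
  rw [show y + z + u = x + (y - x + z + u) by abel, h₁, h₂, hzw u hu]
  congr 1
  abel

theorem isCompact_Vk [FiniteDimensional ℝ E] (L : E ≃ₗ[ℝ] E) (κ : ℝ) (k : ℕ) :
    IsCompact (Vk L κ k) := by
  have : ProperSpace E := FiniteDimensional.proper ℝ E
  exact ((isCompact_closedBall 0 1).image
    (LinearMap.continuous_of_finiteDimensional (L ^ k : E ≃ₗ[ℝ] E).toLinearMap)).add
    (isCompact_closedBall 0 κ)

theorem pow_mul_norm_le_norm_pow (L : E ≃ₗ[ℝ] E) {l : ℝ} (hl : 0 ≤ l)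
    (hnorm : ∀ x : E, l * ‖x‖ ≤ ‖L x‖) (k : ℕ) (x : E) :
    l ^ k * ‖x‖ ≤ ‖(L ^ k) x‖ := by
  induction k with
  | zero => simp
  | succ k ih =>
    calc l ^ (k + 1) * ‖x‖ = l * (l ^ k * ‖x‖) := by ring
      _ ≤ l * ‖(L ^ k) x‖ := by gcongr
      _ ≤ ‖L ((L ^ k) x)‖ := hnorm _
      _ = ‖(L ^ (k + 1)) x‖ := by rw [pow_succ']; rfl

theorem exists_subset_pow_image_closedBall (L : E ≃ₗ[ℝ] E) {l : ℝ} (hl : 1 < l)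
    (hnorm : ∀ x : E, l * ‖x‖ ≤ ‖L x‖) {U : Set E} (hU : IsCompact U) :
    ∃ n : ℕ, U ⊆ ⇑(L ^ n) '' closedBall 0 1 := by
  obtain ⟨r, hr⟩ := hU.isBounded.subset_closedBall 0
  obtain ⟨n, hn⟩ := pow_unbounded_of_one_lt r hl
  refine ⟨n, fun u hu => ?_⟩
  obtain ⟨t, rfl⟩ := (L ^ n).surjective u
  refine mem_image_of_mem _ (mem_closedBall_zero_iff.2 ?_)
  have h₁ := pow_mul_norm_le_norm_pow L (by linarith) hnorm n t
  have h₂ : ‖(L ^ n) t‖ ≤ r := mem_closedBall_zero_iff.1 (hr hu)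
  have h₃ : 0 < l ^ n := by positivity
  exact le_of_mul_le_mul_left (by linarith) h₃

theorem pow_image_closedBall_subset_Vk (L : E ≃ₗ[ℝ] E) {κ : ℝ} (hκ : 0 ≤ κ) (k : ℕ) :
    ⇑(L ^ k) '' closedBall 0 1 ⊆ Vk L κ k :=
  Set.subset_add_left _ (mem_closedBall_self hκ)

/-- Lemma: (i) if `X` meets the centres of all `V⁰`-patches of `P`, then `L^k X` meets
the centres of all `V^k`-patches of `P₋k`; (ii) if `P` is primitive then it is
`ρ`-repetitive with `ρ(V^k) = V^{k+n}` for some `n`, and in particular repetitive. -/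
theorem stmt12 [FiniteDimensional ℝ E] (L : E ≃ₗ[ℝ] E) (hL : IsExpansive L)
    (l : ℝ) (hl : 1 < l) (hnorm : ∀ x : E, l * ‖x‖ ≤ ‖L x‖)
    (P P' : E → S) (hFLC : IsFLC P) (hWS : WellSeparated P) (hLI : LIfrom P' P)
    (c : ℝ) (hc : 0 ≤ c)
    (hder : ∀ x y : E,
      PatchEq (distort L P') (distort L P') x y (closedBall 0 c) → P x = P y)
    (κ : ℝ) (hκ0 : 0 ≤ κ)
    (hκ : ∀ X : Set E,
      ⇑L '' X + closedBall 0 κ + closedBall 0 c ⊆ ⇑L '' (X + closedBall 0 κ))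
    (Sub : (E → S) → (E → S))
    (hmaps : Set.MapsTo Sub (distort L '' patternHull P) (patternHull P))
    (hSubLD : ∀ Q ∈ distort L '' patternHull P, ∀ R ∈ distort L '' patternHull P,
      ∀ x y : E, PatchEq Q R x y (closedBall 0 c) → Sub Q x = Sub R y)
    (hSubP : Sub (distort L P') = P)
    (Pseq : ℤ → E → S) (hmem : ∀ i : ℤ, Pseq i ∈ patternHull P)
    (hσ : ∀ i : ℤ, substMap L Sub (Pseq (i + 1)) = Pseq i)
    (hP0 : Pseq 0 = P) (hP1 : Pseq 1 = P') :
    (∀ X : Set E,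
      (∀ y : E, ∃ x ∈ X, PatchEq P P x y (Vk L κ 0)) →
      ∀ (k : ℕ) (y : E), ∃ x ∈ ⇑(L ^ k) '' X,
        PatchEq (Pseq (-(k : ℤ))) (Pseq (-(k : ℤ))) x y (Vk L κ k)) ∧
    ((∃ X : Set E, IsCompact X ∧ ∀ x y : E, ∃ z ∈ X, PatchEq P P x (y + z) (Vk L κ 0)) →
      (∃ n : ℕ, ∀ (k : ℕ) (x y : E), ∃ v ∈ Vk L κ (k + n),
        PatchEq P P x (y + v) (Vk L κ k)) ∧
      Repetitive P) := by
  refine ⟨fun X hX k y => ?_, fun ⟨X, hXc, hX⟩ => ?_⟩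
  · obtain ⟨y, rfl⟩ := (L ^ k).surjective y
    obtain ⟨x, hx, hxy⟩ := hX y
    rw [← hP0] at hxy
    refine ⟨_, mem_image_of_mem _ hx, ?_⟩
    simpa using patchEq_hierarchy L hκ hSubLD hmem hσ hxy k
  · have hrep : ∃ n : ℕ, ∀ (k : ℕ) (x y : E), ∃ v ∈ Vk L κ (k + n),
        PatchEq P P x (y + v) (Vk L κ k) := by
      obtain ⟨n, hn⟩ := exists_subset_pow_image_closedBall L hl hnorm hXc
      refine ⟨n, fun k x y => ?_⟩
      obtain ⟨x, rfl⟩ := (L ^ k).surjective x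
      obtain ⟨y, rfl⟩ := (L ^ k).surjective y
      obtain ⟨z, hz, hxy⟩ :=
        LIfrom.exists_patchEq_add (hmem k) hXc (isCompact_Vk L κ 0) hX x y
      obtain ⟨t, ht, rfl⟩ := hn hz
      refine ⟨(L ^ k) ((L ^ n) t), pow_image_closedBall_subset_Vk L hκ0 _ ⟨t, ht, ?_⟩, ?_⟩
      · rw [pow_add]
        rfl
      · simpa [hP0] using patchEq_hierarchy L hκ hSubLD hmem hσ hxy k
    refine ⟨hrep, fun U hU => ?_⟩
    obtain ⟨n, hn⟩ := hrep
    obtain ⟨k, hk⟩ := exists_subset_pow_image_closedBall L hl hnorm hU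
    refine ⟨_, isCompact_Vk L κ (k + n), fun x y => ?_⟩
    obtain ⟨v, hv, h⟩ := hn k x y
    exact ⟨v, hv, fun u hu => h u (pow_image_closedBall_subset_Vk L hκ0 k (hk hu))⟩
end

section
/- Let P be a pattern on E, D a set of compact subsets of E, and ρ : D → {compact subsets of E}; suppose P is ρ-repetitive. Take any U ∈ D with 0 ∈ U. If there exist x ∈ E and u ∈ U such that P[x, ρ(U)] = P[x+u, ρ(U)], then u ∈ K_P. -/
open Metric Set Filter Topology Pointwise

variable {E : Type*} [NormedAddCommGroup E] [NormedSpace ℝ E] {S : Type*}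

/-- Lemma: for a `ρ`-repetitive pattern, a repeat of a `ρ(U)`-patch displaced by a
vector `u ∈ U` (with `0 ∈ U ∈ D`) forces `u` to be a period. -/
theorem stmt13 (P : E → S) (D : Set (Set E)) (hD : ∀ U ∈ D, IsCompact U)
    (ρ : Set E → Set E) (hρ : ∀ U ∈ D, IsCompact (ρ U))
    (hrep : ∀ x y : E, ∀ U ∈ D, ∃ v ∈ ρ U, PatchEq P P x (y + v) U)
    (U : Set E) (hU : U ∈ D) (hU0 : (0 : E) ∈ U)
    (x u : E) (hu : u ∈ U) (h : PatchEq P P x (x + u) (ρ U)) :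
    u ∈ periods P := by
  intro z
  obtain ⟨v, hv, hvU⟩ := hrep z x U hU
  have h0 := hvU 0 hU0
  rw [add_zero, add_zero] at h0
  rw [hvU u hu, h0, h v hv, add_right_comm]
end

section
/- Let P be a pattern on E, let U ⊆ E with 0 ∈ U, let V ⊆ E be compact, and let x ∈ E be such that every U-patch of P occurs with centre within V of x, i.e., for every y ∈ E there exists v ∈ V with P[x+v,U] = P[y,U]. If P[x,V] = P[x+u,V] for some u ∈ U, then u ∈ K_P. -/
open Metric Set Filter Topology Pointwise

variable {E : Type*} [NormedAddCommGroup E] [NormedSpace ℝ E] {S : Type*}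

/-- Lemma: if all `U`-patches of `P` occur with centre within `V` of `x` and the
`V`-patch at `x` repeats at `x + u` for some `u ∈ U ∋ 0`, then `u` is a period. -/
theorem stmt14 (P : E → S) (U : Set E) (hU0 : (0 : E) ∈ U)
    (V : Set E) (hV : IsCompact V) (x : E)
    (hall : ∀ y : E, ∃ v ∈ V, PatchEq P P (x + v) y U)
    (u : E) (hu : u ∈ U) (h : PatchEq P P x (x + u) V) :
    u ∈ periods P := by
  intro y
  obtain ⟨v, hv, hvy⟩ := hall y
  have h₀ : P (x + v) = P y := by simpa using hvy 0 hU0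
  rw [← hvy u hu, add_right_comm, ← h v hv, h₀]
end

section
/- If Ω is an FLC, well-separated pattern space that is L-sub with L expansive and substitution σ = S ∘ L, then there exist P ∈ Ω and n ∈ ℕ with σⁿ(P) = P. In particular, Ω contains a pseudo self-affine point for some power of L, i.e., a pattern P with P locally derivable from LⁿP for some n ∈ ℕ. -/
open Metric Set Filter Topology Pointwise

variable {E : Type*} [NormedAddCommGroup E] [NormedSpace ℝ E] {S : Type*}

lemma substMap_mapsTo {L : E ≃ₗ[ℝ] E} {Ω : Set (E → S)} {Sub : (E → S) → (E → S)}
    (hSub : Set.MapsTo Sub (distort L '' Ω) Ω) : Set.MapsTo (substMap L Sub) Ω Ω :=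
  fun _ hP => hSub (mem_image_of_mem _ hP)

/-- A pattern space is invariant under translation. -/
lemma IsPatternSpace.translate_mem {Ω : Set (E → S)} (hΩ : IsPatternSpace Ω) {Q : E → S}
    (hQ : Q ∈ Ω) (x : E) : (fun u => Q (x + u)) ∈ Ω :=
  hΩ.2 _ fun _ _ z => ⟨Q, hQ, x + z, fun u _ => by simp only [add_assoc]⟩

/-- All iterates of the substitution are local with a common radius, measured before inflation. -/
lemma exists_uniform_radius {L : E ≃ₗ[ℝ] E} (hL : IsExpansive L) {Ω : Set (E → S)}
    {Sub : (E → S) → (E → S)} (hSub : IsLDMapOn Sub (distort L '' Ω) Ω) :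
    ∃ D : ℝ, 0 ≤ D ∧ ∀ n : ℕ, ∀ P ∈ Ω, ∀ Q ∈ Ω, ∀ x y : E,
      PatchEq P Q x y (closedBall 0 D) →
        (substMap L Sub)^[n] P ((L ^ n) x) = (substMap L Sub)^[n] Q ((L ^ n) y) := by
  obtain ⟨C, hC, l, hl, hexp⟩ := hL
  obtain ⟨hmaps, c, hc, hloc⟩ := hSub
  have hl0 : 0 < l := by linarith
  have hl1 : 0 < l - 1 := by linarith
  set D : ℝ := c / (C * (l - 1)) with hD
  have hD0 : 0 ≤ D := by positivity
  refine ⟨D, hD0, ?_⟩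
  have key : ∀ n : ℕ, ∀ P ∈ Ω, ∀ Q ∈ Ω, ∀ x y : E,
      PatchEq P Q x y (closedBall 0 (D * (1 - (l ^ n)⁻¹))) →
        (substMap L Sub)^[n] P ((L ^ n) x) = (substMap L Sub)^[n] Q ((L ^ n) y) := by
    intro n
    induction n with
    | zero =>
      intro P _ Q _ x y h
      simpa using h 0 (by simp)
    | succ n ih =>
      intro P hP Q hQ x y h
      rw [Function.iterate_succ_apply', Function.iterate_succ_apply']
      have hmem := (substMap_mapsTo hmaps).iterate n
      refine hloc _ (mem_image_of_mem _ (hmem hP)) _ (mem_image_of_mem _ (hmem hQ)) _ _ ?_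
      intro b hb
      rw [mem_closedBall_zero_iff] at hb
      obtain ⟨w, rfl⟩ := (L ^ (n + 1)).surjective b
      have hw : ‖w‖ ≤ c / (C * l ^ (n + 1)) := by
        rw [le_div_iff₀ (by positivity), mul_comm]
        exact (hexp (n + 1) w).trans hb
      have hstep : c / (C * l ^ (n + 1)) + D * (1 - (l ^ n)⁻¹) =
          D * (1 - (l ^ (n + 1))⁻¹) := by
        rw [hD]
        field_simp
        ring
      have hinv : ∀ z : E, L.symm ((L ^ (n + 1)) z) = (L ^ n) z := fun z => by
        rw [pow_succ', LinearEquiv.mul_apply, LinearEquiv.symm_apply_apply]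
      simp only [distort, ← map_add, hinv]
      refine ih P hP Q hQ _ _ fun u hu => ?_
      rw [mem_closedBall_zero_iff] at hu
      rw [add_assoc, add_assoc]
      refine h _ ?_
      rw [mem_closedBall_zero_iff]
      exact (norm_add_le _ _).trans (by linarith)
  intro n P hP Q hQ x y h
  refine key n P hP Q hQ x y fun u hu => h u (closedBall_subset_closedBall ?_ hu)
  have : 0 ≤ (l ^ n)⁻¹ := by positivity
  nlinarith

/-- In an FLC space, every sequence of patterns has two terms, arbitrarily far apart in the
sequence, whose `U`-patches at the origin occur at nearby points of a single pattern. -/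
lemma exists_patch_recurrence {Ω : Set (E → S)} (hFLC : IsFLCSpace Ω) {U : Set E}
    (hU : IsCompact U) {Q : ℕ → E → S} (hQ : ∀ k, Q k ∈ Ω) (m : ℕ) :
    ∃ a b : ℕ, a + m ≤ b ∧ ∃ (R : E → S) (y z : E), ‖z - y‖ ≤ 1 ∧
      PatchEq (Q a) R 0 y U ∧ PatchEq (Q b) R 0 z U := by
  obtain ⟨N, Ps, Ks, hK, hcov⟩ := hFLC U hU
  choose i y hyK hy using fun k => hcov (Q k) (hQ k) 0
  have hcpt : IsCompact ((univ : Set (Fin N)) ×ˢ ⋃ i, Ks i) :=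
    isCompact_univ.prod (isCompact_iUnion hK)
  obtain ⟨⟨j, p⟩, -, φ, hφ, hlim⟩ := hcpt.tendsto_subseq (x := fun k => (i k, y k))
    fun k => ⟨mem_univ _, mem_iUnion.2 ⟨_, hyK k⟩⟩
  rw [Prod.tendsto_iff] at hlim
  have h1 : ∀ᶠ k in atTop, i (φ k) = j := by
    have := hlim.1.eventually_mem (show {j} ∈ 𝓝 j by simp)
    simpa using this
  have h2 : ∀ᶠ k in atTop, dist (y (φ k)) p < 1 / 2 :=
    hlim.2.eventually_mem (ball_mem_nhds p (by norm_num))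
  obtain ⟨k, hk⟩ := eventually_atTop.1 (h1.and h2)
  refine ⟨φ k, φ (k + m), ?_, Ps j, y (φ k), y (φ (k + m)), ?_, ?_, ?_⟩
  · have := hφ.add_le_nat m k
    rwa [add_comm, add_comm k]
  · rw [← dist_eq_norm]
    have := dist_triangle_right (y (φ (k + m))) (y (φ k)) p
    linarith [(hk k le_rfl).2, (hk (k + m) (by omega)).2]
  · simpa [(hk k le_rfl).1] using hy (φ k)
  · simpa [(hk (k + m) (by omega)).1] using hy (φ (k + m))

/-- A local map which inflates by a factor at least `2` has a fixed point as soon as some pattern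
agrees with its image on a large ball about the origin. -/
lemma exists_fixed_of_patchEq {Ω : Set (E → S)} (hΩ : IsPatternSpace Ω)
    {T : (E → S) → (E → S)} (hT : Set.MapsTo T Ω Ω) (M : E ≃ₗ[ℝ] E)
    (hM : ∀ x, 2 * ‖x‖ ≤ ‖M x‖) {D : ℝ}
    (hloc : ∀ P ∈ Ω, ∀ Q ∈ Ω, ∀ x y : E,
      PatchEq P Q x y (closedBall 0 D) → T P (M x) = T Q (M y))
    {Q : E → S} (hQ : Q ∈ Ω) {r : ℝ} (hr : 2 * D + 1 ≤ r) (hr0 : 0 ≤ r)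
    (hQT : ∀ u, ‖u‖ ≤ r → Q u = T Q u) : ∃ P ∈ Ω, T P = P := by
  have hmem : ∀ k, T^[k] Q ∈ Ω := fun k => hT.iterate k hQ
  have hsucc : ∀ k : ℕ, ∀ u, ‖u‖ ≤ r + k → T^[k] Q u = T^[k + 1] Q u := by
    intro k
    induction k with
    | zero => simpa using hQT
    | succ k ih =>
      intro u hu
      rw [Function.iterate_succ_apply', Function.iterate_succ_apply' T (k + 1)]
      obtain ⟨w, rfl⟩ := M.surjective u
      refine hloc _ (hmem _) _ (hmem _) w w fun v hv => ih _ ?_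
      rw [mem_closedBall_zero_iff] at hv
      have h1 := hM w
      have h2 := norm_add_le w v
      have h3 : (0 : ℝ) ≤ k := k.cast_nonneg
      push_cast at hu
      linarith
  have hstab : ∀ (u : E) (k d : ℕ), ‖u‖ ≤ k → T^[k + d] Q u = T^[k] Q u := by
    intro u k d hu
    induction d with
    | zero => rfl
    | succ d ih =>
      rw [← ih]
      refine (hsucc (k + d) u ?_).symm
      have h3 : (0 : ℝ) ≤ d := d.cast_nonneg
      push_cast
      linarith
  set P : E → S := fun u => T^[⌈‖u‖⌉₊] Q u
  have hPk : ∀ (k : ℕ) (u : E), ‖u‖ ≤ k → P u = T^[k] Q u := by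
    intro k u hu
    obtain ⟨d, rfl⟩ := Nat.exists_eq_add_of_le (Nat.ceil_le.2 hu)
    exact (hstab u _ d (Nat.le_ceil _)).symm
  have hPΩ : P ∈ Ω := by
    refine hΩ.2 P fun U hU x => ?_
    obtain ⟨R, hR⟩ := hU.isBounded.exists_norm_le
    obtain ⟨k, hk⟩ := exists_nat_ge (‖x‖ + R)
    refine ⟨T^[k] Q, hmem k, x, fun u hu => hPk k _ ?_⟩
    exact (norm_add_le _ _).trans (by linarith [hR u hu])
  refine ⟨P, hPΩ, funext fun v => ?_⟩
  obtain ⟨w, rfl⟩ := M.surjective v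
  obtain ⟨k, hk⟩ := exists_nat_ge (max (‖w‖ + D) ‖M w‖)
  rw [max_le_iff] at hk
  have h1 : T P (M w) = T (T^[k] Q) (M w) := by
    refine hloc _ hPΩ _ (hmem k) w w fun u hu => hPk k _ ?_
    rw [mem_closedBall_zero_iff] at hu
    exact (norm_add_le _ _).trans (by linarith [hk.1])
  rw [h1, ← Function.iterate_succ_apply' T, hPk (k + 1) (M w) (by push_cast; linarith [hk.2])]

/-- Proposition: an FLC, well-separated, expansive `L`-sub pattern space contains a
periodic point of some power of substitution; in particular it contains a pseudo
self-affine point for some power of `L`. -/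
theorem stmt15 [FiniteDimensional ℝ E] (L : E ≃ₗ[ℝ] E) (hL : IsExpansive L)
    (Ω : Set (E → S)) (hΩ : IsPatternSpace Ω) (hFLC : IsFLCSpace Ω)
    (hWS : WellSeparatedSpace Ω)
    (Sub : (E → S) → (E → S)) (hSub : IsLSubSpace L Ω Sub) :
    (∃ P ∈ Ω, ∃ n : ℕ, 0 < n ∧ (substMap L Sub)^[n] P = P) ∧
    ∃ P ∈ Ω, ∃ n : ℕ, 0 < n ∧ LD (distort (L ^ n) P) P := by
  obtain ⟨D, hD, hloc⟩ := exists_uniform_radius hL hSub.1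
  have hmaps := substMap_mapsTo hSub.1.1
  set σ := substMap L Sub
  obtain ⟨P, hP, n, hn, hfix⟩ : ∃ P ∈ Ω, ∃ n : ℕ, 0 < n ∧ σ^[n] P = P := by
    obtain ⟨C, hC, l, hl, hexp⟩ := hL
    obtain ⟨P₀, hP₀⟩ := hΩ.1
    obtain ⟨m, hm⟩ := pow_unbounded_of_one_lt (2 / C) hl
    set r : ℝ := 2 * D + 3 with hr
    obtain ⟨a, b, hab, R, y, z, hyz, hya, hzb⟩ := exists_patch_recurrence hFLC
      (isCompact_closedBall (0 : E) r) (fun k => hmaps.iterate k hP₀) (m + 1)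
    obtain ⟨n, rfl⟩ := Nat.exists_eq_add_of_le' (show a ≤ b by omega)
    have hnm : m < n := by omega
    have hM : ∀ x, 2 * ‖x‖ ≤ ‖(L ^ n : E ≃ₗ[ℝ] E) x‖ := by
      intro x
      refine le_trans (mul_le_mul_of_nonneg_right ?_ (norm_nonneg x)) (hexp n x)
      rw [← div_le_iff₀' hC]
      exact hm.le.trans (pow_le_pow_right₀ hl.le hnm.le)
    set Q := σ^[a] P₀ with hQdef
    have hQ : Q ∈ Ω := hmaps.iterate a hP₀
    rw [Function.iterate_add_apply, ← hQdef] at hzb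
    obtain ⟨x, hx⟩ : ∃ x : E, (L ^ n : E ≃ₗ[ℝ] E) x - x = -(z - y) := by
      set f : E →ₗ[ℝ] E := (L ^ n : E ≃ₗ[ℝ] E).toLinearMap - LinearMap.id
      have hinj : Function.Injective f := by
        rw [injective_iff_map_eq_zero]
        intro v hv
        have hv' : (L ^ n : E ≃ₗ[ℝ] E) v = v := sub_eq_zero.1 hv
        have := hM v
        rw [hv'] at this
        exact norm_le_zero_iff.1 (by linarith)
      exact LinearMap.injective_iff_surjective.1 hinj _
    have hx1 : ‖x‖ ≤ 1 := by
      have h1 := hM x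
      have h2 : ‖(L ^ n : E ≃ₗ[ℝ] E) x‖ ≤ ‖x‖ + ‖z - y‖ := by
        rw [sub_eq_iff_eq_add.1 hx, add_comm, ← sub_eq_add_neg]
        exact norm_sub_le _ _
      linarith
    obtain ⟨P, hP, hfix⟩ := exists_fixed_of_patchEq hΩ (hmaps.iterate n) (L ^ n) hM
      (hloc n) (hΩ.translate_mem hQ x) (r := 2 * D + 1) le_rfl (by linarith) (by
        intro u hu
        have htr : σ^[n] (fun u => Q (x + u)) u = σ^[n] Q ((L ^ n : E ≃ₗ[ℝ] E) x + u) := by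
          obtain ⟨w, rfl⟩ := (L ^ n : E ≃ₗ[ℝ] E).surjective u
          rw [← map_add]
          exact hloc n _ (hΩ.translate_mem hQ x) _ hQ _ _ fun v _ => by simp only [add_assoc]
        have hLx : (L ^ n : E ≃ₗ[ℝ] E) x = x - (z - y) := by
          rw [sub_eq_iff_eq_add.1 hx]; abel
        rw [htr, hLx]
        have h1 := hya (x + u) (by
          rw [mem_closedBall_zero_iff]
          exact (norm_add_le _ _).trans (by linarith))
        have h2 := hzb (x - (z - y) + u) (by
          rw [mem_closedBall_zero_iff]
          exact (norm_add_le _ _).trans (by linarith [norm_sub_le x (z - y)]))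
        rw [zero_add] at h1 h2
        rw [h1, h2]
        congr 1
        abel)
    exact ⟨P, hP, n, by omega, hfix⟩
  refine ⟨⟨P, hP, n, hn, hfix⟩, P, hP, n, hn, ?_⟩
  set A : E →L[ℝ] E := LinearMap.toContinuousLinearMap ((L ^ n : E ≃ₗ[ℝ] E) : E →ₗ[ℝ] E)
  refine ⟨‖A‖ * D, by positivity, fun x y h => ?_⟩
  obtain ⟨v, rfl⟩ := (L ^ n : E ≃ₗ[ℝ] E).surjective x
  obtain ⟨w, rfl⟩ := (L ^ n : E ≃ₗ[ℝ] E).surjective y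
  rw [← hfix]
  refine hloc n P hP P hP v w fun u hu => ?_
  have hAu : (L ^ n : E ≃ₗ[ℝ] E) u ∈ closedBall (0 : E) (‖A‖ * D) := by
    rw [mem_closedBall_zero_iff] at hu ⊢
    exact (A.le_opNorm u).trans (by gcongr)
  simpa [distort, ← map_add] using h _ hAu
end
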